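/- For every d ≥ 1 and every x ∈ ℝ^d, the function p ↦ ‖p − x‖² attains a minimum on the probability simplex Δ^{d−1} at a unique point sparsemax(x), and this minimizer is given coordinatewise by [sparsemax(x)]_j = max(0, x_j − τ(x)), where τ(x) is the unique real number satisfying Σ_{j=1}^d max(0, x_j − τ(x)) = 1. -/

import Mathlib

/-- The sum of the positive parts of `x j - τ` takes the value `1` for some threshold `τ`. -/
theorem exists_sum_max_zero_sub_eq_one {ι : Type*} [Fintype ι] [Nonempty ι] (x : ι → ℝ) :
    ∃ τ : ℝ, ∑ j, max 0 (x j - τ) = 1 := by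
  obtain ⟨i⟩ := ‹Nonempty ι›
  have hle (j : ι) : x j ≤ ∑ k, |x k| :=
    (le_abs_self _).trans
      (Finset.single_le_sum (f := fun k => |x k|) (fun k _ => abs_nonneg _) (Finset.mem_univ j))
  have hcont : Continuous fun τ : ℝ => ∑ j, max 0 (x j - τ) := by fun_prop
  have hright : ∑ j, max 0 (x j - ∑ k, |x k|) = 0 :=
    Finset.sum_eq_zero fun j _ => max_eq_left (sub_nonpos.2 (hle j))
  have hleft : 1 ≤ ∑ j, max 0 (x j - (x i - 1)) := by
    refine le_trans ?_ (Finset.single_le_sum (f := fun j => max 0 (x j - (x i - 1)))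
      (fun j _ => le_max_left _ _) (Finset.mem_univ i))
    simp
  obtain ⟨τ, -, hτ⟩ := intermediate_value_Icc' (by linarith [hle i]) hcont.continuousOn
    ⟨hright.trans_le zero_le_one, hleft⟩
  exact ⟨τ, hτ⟩

/-- Quadratic growth of the squared distance to `x` on the probability simplex around the
thresholded vector `max 0 (x j - τ)`. -/
theorem sum_sq_add_sum_sq_le_of_mem_stdSimplex {ι : Type*} [Fintype ι] {x q : ι → ℝ} {τ : ℝ}
    (hτ : ∑ j, max 0 (x j - τ) = 1) (hq : q ∈ stdSimplex ℝ ι) :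
    ∑ j, (max 0 (x j - τ) - x j) ^ 2 + ∑ j, (q j - max 0 (x j - τ)) ^ 2
      ≤ ∑ j, (q j - x j) ^ 2 := by
  have hpoint (j : ι) : (max 0 (x j - τ) - x j) ^ 2 + (q j - max 0 (x j - τ)) ^ 2
      ≤ (q j - x j) ^ 2 + 2 * τ * (q j - max 0 (x j - τ)) := by
    rcases le_total (x j - τ) 0 with h | h
    · rw [max_eq_left h]
      nlinarith [mul_nonneg (hq.1 j) (sub_nonneg.2 h)]
    · rw [max_eq_right h]
      linarith
  have hsum := Finset.sum_le_sum fun j (_ : j ∈ Finset.univ) => hpoint j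
  rw [Finset.sum_add_distrib, Finset.sum_add_distrib, ← Finset.mul_sum, Finset.sum_sub_distrib,
    hτ, hq.2] at hsum
  linarith

/-- For every `d ≥ 1` and `x ∈ ℝ^d`, the function `p ↦ ‖p − x‖²` attains its minimum on the
probability simplex `Δ^{d−1}` at a unique point, and this minimizer `sparsemax(x)` is given
coordinatewise by `max(0, x_j − τ(x))`, where `τ(x)` is the unique real number satisfying
`Σ_j max(0, x_j − τ(x)) = 1`. -/
theorem stmt10 (d : ℕ) (hd : 1 ≤ d) (x : Fin d → ℝ) :
    ∃ τ : ℝ, (∑ j, max 0 (x j - τ) = 1) ∧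
      (fun j => max 0 (x j - τ)) ∈ stdSimplex ℝ (Fin d) ∧
      (∀ q ∈ stdSimplex ℝ (Fin d),
        ∑ j, (max 0 (x j - τ) - x j) ^ 2 ≤ ∑ j, (q j - x j) ^ 2) ∧
      (∀ q ∈ stdSimplex ℝ (Fin d),
        (∀ p ∈ stdSimplex ℝ (Fin d), ∑ j, (q j - x j) ^ 2 ≤ ∑ j, (p j - x j) ^ 2) →
        q = fun j => max 0 (x j - τ)) := by
  have : Nonempty (Fin d) := ⟨⟨0, hd⟩⟩
  obtain ⟨τ, hτ⟩ := exists_sum_max_zero_sub_eq_one x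
  have hmem : (fun j => max 0 (x j - τ)) ∈ stdSimplex ℝ (Fin d) :=
    ⟨fun j => le_max_left _ _, hτ⟩
  refine ⟨τ, hτ, hmem, fun q hq => ?_, fun q hq hmin => ?_⟩
  · have hnonneg : 0 ≤ ∑ j, (q j - max 0 (x j - τ)) ^ 2 :=
      Finset.sum_nonneg fun j _ => sq_nonneg _
    linarith [sum_sq_add_sum_sq_le_of_mem_stdSimplex hτ hq]
  · have hle : ∑ j, (q j - max 0 (x j - τ)) ^ 2 ≤ 0 := by
      linarith [sum_sq_add_sum_sq_le_of_mem_stdSimplex hτ hq, hmin _ hmem]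
    funext j
    have hj : (q j - max 0 (x j - τ)) ^ 2 ≤ 0 :=
      (Finset.single_le_sum (f := fun j => (q j - max 0 (x j - τ)) ^ 2)
        (fun j _ => sq_nonneg _) (Finset.mem_univ j)).trans hle
    exact sub_eq_zero.1 (sq_nonpos_iff _ |>.1 hj)
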